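/- Let a = π/12, Δ = Δ_hex(π/12), Λ = (2Δ) × 2πℤ, φ₀(x,y,z) = (R_{π/3}(x,y), z + π/3), and let Γ₆ be the group of isometries of (ℝ³, h) generated by the translations by Λ and by φ₀ (so ℝ³/Γ₆ is the orientable Bieberbach manifold C₆ with the singular metric g_hex). Then: (i) the systole of (C₆, g_hex), i.e. the infimum of L_Δ(γ) over all g ∈ Γ₆ \ {id}, m ∈ ℝ³, and piecewise C¹ curves γ from m to g(m), equals π/3; and (ii) with V := (4π/3) · ∫_{H(Δ)} cos(‖p‖) dp, the Riemannian volume of (C₆, g_hex), one has (π/3)³ > (2/√3) · V. Hence the systolic ratio of (C₆, g_hex) is strictly greater than 2/√3, the optimal systolic ratio among flat metrics on C₆. -/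

import Mathlib

open Real MeasureTheory Set

noncomputable section

/-- The point `(x, y)` of the Euclidean plane. -/
def pt2 (x y : ℝ) : EuclideanSpace ℝ (Fin 2) := (WithLp.equiv 2 (Fin 2 → ℝ)).symm ![x, y]

/-- `f : [0,1] → ℝ` is piecewise `C¹`. -/
def PC1 (f : ℝ → ℝ) : Prop :=
  ∃ (n : ℕ) (t : ℕ → ℝ), t 0 = 0 ∧ t n = 1 ∧ (∀ i < n, t i < t (i + 1)) ∧
    ContinuousOn f (Set.Icc 0 1) ∧ ∀ i < n, ContDiffOn ℝ 1 f (Set.Icc (t i) (t (i + 1)))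

/-- Length of `γ = (γ₁,γ₂,γ₃)` for the singular metric
`h = dx² + dy² + cos²(dist((x,y),Δ)) dz²`. -/
def sLen (Δ : Set (EuclideanSpace ℝ (Fin 2))) (γ₁ γ₂ γ₃ : ℝ → ℝ) : ℝ :=
  ∫ t in (0:ℝ)..1, Real.sqrt ((deriv γ₁ t) ^ 2 + (deriv γ₂ t) ^ 2 +
    Real.cos (Metric.infDist (pt2 (γ₁ t) (γ₂ t)) Δ) ^ 2 * (deriv γ₃ t) ^ 2)

/-- The hexagonal lattice `Δ_hex(a) = ℤ·(2a,0) + ℤ·(a, a√3) ⊂ ℝ²`. -/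
def ΔhexE (a : ℝ) : Set (EuclideanSpace ℝ (Fin 2)) :=
  {p | ∃ m n : ℤ, p = pt2 (2 * a * m + a * n) (a * Real.sqrt 3 * n)}

/-- The spatial lattice `Λ = (2Δ_hex(a)) × 2πℤ ⊂ ℝ³`. -/
def Λhex3 (a : ℝ) : Set (ℝ × ℝ × ℝ) :=
  {w | ∃ k₁ k₂ k₃ : ℤ, w = (4 * a * k₁ + 2 * a * k₂, 2 * a * Real.sqrt 3 * k₂, 2 * π * k₃)}

/-- The closed Voronoi cell `H(Δ)` of `0` of a planar lattice `Δ`. -/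
def vorCell (Δ : Set (EuclideanSpace ℝ (Fin 2))) : Set (EuclideanSpace ℝ (Fin 2)) :=
  {p | ∀ q ∈ Δ, ‖p‖ ≤ ‖p - q‖}

/-- The screw motion `φ₀(x,y,z) = (R_{π/3}(x,y), z + π/3)` as a bijection of `ℝ³`, where
`R_θ` is the rotation of `ℝ²` about the origin by the angle `θ`. -/
def phi0Perm : Equiv.Perm (ℝ × ℝ × ℝ) where
  toFun p := (Real.cos (π / 3) * p.1 - Real.sin (π / 3) * p.2.1,
              Real.sin (π / 3) * p.1 + Real.cos (π / 3) * p.2.1, p.2.2 + π / 3)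
  invFun p := (Real.cos (π / 3) * p.1 + Real.sin (π / 3) * p.2.1,
               -(Real.sin (π / 3)) * p.1 + Real.cos (π / 3) * p.2.1, p.2.2 - π / 3)
  left_inv := by
    rintro ⟨x, y, z⟩
    have h := Real.sin_sq_add_cos_sq (π / 3)
    simp only [Prod.mk.injEq]
    exact ⟨by linear_combination x * h, by linear_combination y * h, by ring⟩
  right_inv := by
    rintro ⟨x, y, z⟩
    have h := Real.sin_sq_add_cos_sq (π / 3)
    simp only [Prod.mk.injEq]
    exact ⟨by linear_combination x * h, by linear_combination y * h, by ring⟩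

/-- The group `Γ₆` of isometries of `(ℝ³, h)` generated by the translations by
`Λ = (2Δ_hex(π/12)) × 2πℤ` and by `φ₀`; `ℝ³/Γ₆` is the Bieberbach manifold `C₆` with the
singular metric `g_hex`. -/
def Γ₆ : Subgroup (Equiv.Perm (ℝ × ℝ × ℝ)) :=
  Subgroup.closure ((fun w => Equiv.addLeft w) '' Λhex3 (π / 12) ∪ {phi0Perm})

/-- The integrand of `sLen`. -/
def speed (Δ : Set (EuclideanSpace ℝ (Fin 2))) (γ₁ γ₂ γ₃ : ℝ → ℝ) (t : ℝ) : ℝ :=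
  Real.sqrt ((deriv γ₁ t) ^ 2 + (deriv γ₂ t) ^ 2 +
    Real.cos (Metric.infDist (pt2 (γ₁ t) (γ₂ t)) Δ) ^ 2 * (deriv γ₃ t) ^ 2)

lemma sLen_eq_integral_speed (Δ : Set (EuclideanSpace ℝ (Fin 2))) (γ₁ γ₂ γ₃ : ℝ → ℝ) :
    sLen Δ γ₁ γ₂ γ₃ = ∫ t in (0:ℝ)..1, speed Δ γ₁ γ₂ γ₃ t := rfl

lemma speed_nonneg (Δ : Set (EuclideanSpace ℝ (Fin 2))) (γ₁ γ₂ γ₃ : ℝ → ℝ) (t : ℝ) :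
    0 ≤ speed Δ γ₁ γ₂ γ₃ t := Real.sqrt_nonneg _

lemma continuous_pt2 : Continuous fun p : ℝ × ℝ => pt2 p.1 p.2 := by
  unfold pt2
  refine (PiLp.continuous_toLp 2 _).comp ?_
  refine continuous_pi fun i => ?_
  fin_cases i
  · exact continuous_fst
  · exact continuous_snd

lemma PC1.continuousOn {f : ℝ → ℝ} (hf : PC1 f) : ContinuousOn f (Icc 0 1) := by
  obtain ⟨n, t, -, -, -, h, -⟩ := hf
  exact h

/-- A piecewise `C¹` function is differentiable with bounded derivative off a finite set. -/
lemma PC1.exists_finite_deriv_bound {f : ℝ → ℝ} (hf : PC1 f) :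
    ∃ S : Set ℝ, S.Finite ∧ ∃ C : ℝ, ∀ x ∈ Ioo (0:ℝ) 1 \ S,
      DifferentiableAt ℝ f x ∧ |deriv f x| ≤ C := by
  obtain ⟨n, t, h0, h1, hlt, -, hd⟩ := hf
  have hB : ∀ i : ℕ, ∃ C : ℝ, i < n → ∀ x ∈ Ioo (t i) (t (i + 1)),
      DifferentiableAt ℝ f x ∧ |deriv f x| ≤ C := by
    intro i
    by_cases hi : i < n
    · have hc := (hd i hi).continuousOn_derivWithin (uniqueDiffOn_Icc (hlt i hi)) le_rfl
      obtain ⟨C, hC⟩ := isCompact_Icc.exists_bound_of_continuousOn hc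
      refine ⟨C, fun _ x hx => ?_⟩
      have hn : Icc (t i) (t (i + 1)) ∈ nhds x := Icc_mem_nhds hx.1 hx.2
      refine ⟨((hd i hi).differentiableOn one_ne_zero x (Ioo_subset_Icc_self hx)).differentiableAt
        hn, ?_⟩
      rw [← derivWithin_of_mem_nhds hn]
      exact hC x (Ioo_subset_Icc_self hx)
    · exact ⟨0, fun h => absurd h hi⟩
  choose C hC using hB
  refine ⟨t '' Set.Iic n, (Set.finite_Iic n).image t, ∑ i ∈ Finset.range n, |C i|, ?_⟩
  rintro x ⟨hx, hxS⟩
  have hex : ∃ j, x ≤ t j := ⟨n, h1 ▸ hx.2.le⟩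
  classical
  set j := Nat.find hex with hj
  have hjn : j ≤ n := Nat.find_min' hex (h1 ▸ hx.2.le)
  have hxj : x ≤ t j := Nat.find_spec hex
  have hxj' : x < t j := lt_of_le_of_ne hxj fun h => hxS ⟨j, hjn, h.symm⟩
  have hj0 : j ≠ 0 := by
    intro h
    rw [h, h0] at hxj
    linarith [hx.1]
  obtain ⟨i, hi⟩ := Nat.exists_eq_succ_of_ne_zero hj0
  have hxi : t i < x := by
    by_contra hcon
    exact Nat.find_min hex (m := i) (by omega) (not_lt.mp hcon)
  have hin : i < n := by omega
  rw [hi] at hxj'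
  obtain ⟨hd1, hd2⟩ := hC i hin x ⟨hxi, hxj'⟩
  refine ⟨hd1, hd2.trans ((le_abs_self _).trans ?_)⟩
  exact Finset.single_le_sum (f := fun i => |C i|) (fun _ _ => abs_nonneg _)
    (Finset.mem_range.mpr hin)

section Curve

variable {Δ : Set (EuclideanSpace ℝ (Fin 2))} {γ₁ γ₂ γ₃ : ℝ → ℝ}

lemma exists_finite_differentiableAt_speed_bound (h₁ : PC1 γ₁) (h₂ : PC1 γ₂) (h₃ : PC1 γ₃) :
    ∃ S : Set ℝ, S.Finite ∧ ∃ C : ℝ, ∀ x ∈ Ioo (0:ℝ) 1 \ S,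
      DifferentiableAt ℝ γ₁ x ∧ DifferentiableAt ℝ γ₂ x ∧ DifferentiableAt ℝ γ₃ x ∧
      speed Δ γ₁ γ₂ γ₃ x ≤ C := by
  obtain ⟨S₁, f₁, C₁, b₁⟩ := h₁.exists_finite_deriv_bound
  obtain ⟨S₂, f₂, C₂, b₂⟩ := h₂.exists_finite_deriv_bound
  obtain ⟨S₃, f₃, C₃, b₃⟩ := h₃.exists_finite_deriv_bound
  refine ⟨S₁ ∪ S₂ ∪ S₃, (f₁.union f₂).union f₃, √(C₁ ^ 2 + C₂ ^ 2 + 1 * C₃ ^ 2), ?_⟩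
  rintro x ⟨hx, hxS⟩
  simp only [mem_union, not_or] at hxS
  obtain ⟨d₁, e₁⟩ := b₁ x ⟨hx, hxS.1.1⟩
  obtain ⟨d₂, e₂⟩ := b₂ x ⟨hx, hxS.1.2⟩
  obtain ⟨d₃, e₃⟩ := b₃ x ⟨hx, hxS.2⟩
  refine ⟨d₁, d₂, d₃, Real.sqrt_le_sqrt ?_⟩
  have q₁ := sq_le_sq' (neg_le_of_abs_le e₁) (le_of_abs_le e₁)
  have q₂ := sq_le_sq' (neg_le_of_abs_le e₂) (le_of_abs_le e₂)
  have q₃ := sq_le_sq' (neg_le_of_abs_le e₃) (le_of_abs_le e₃)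
  gcongr
  exact Real.cos_sq_le_one _

lemma PC1.aestronglyMeasurable_speed (h₁ : PC1 γ₁) (h₂ : PC1 γ₂) :
    AEStronglyMeasurable (speed Δ γ₁ γ₂ γ₃) (volume.restrict (Ioo 0 1)) := by
  have hpt : ContinuousOn (fun t => pt2 (γ₁ t) (γ₂ t)) (Icc 0 1) :=
    continuous_pt2.comp_continuousOn (h₁.continuousOn.prodMk h₂.continuousOn)
  have hdist : ContinuousOn (fun t => Metric.infDist (pt2 (γ₁ t) (γ₂ t)) Δ) (Icc 0 1) :=
    (Metric.continuous_infDist_pt Δ).comp_continuousOn hpt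
  have hcos : AEStronglyMeasurable
      (fun t => Real.cos (Metric.infDist (pt2 (γ₁ t) (γ₂ t)) Δ) ^ 2)
      (volume.restrict (Ioo 0 1)) :=
    (((Real.continuous_cos.comp_continuousOn hdist).pow 2).mono Ioo_subset_Icc_self
      ).aestronglyMeasurable measurableSet_Ioo
  have m (γ : ℝ → ℝ) :
      AEStronglyMeasurable (fun t => deriv γ t ^ 2) (volume.restrict (Ioo (0:ℝ) 1)) :=
    ((measurable_deriv γ).pow_const 2).aestronglyMeasurable
  exact Real.continuous_sqrt.comp_aestronglyMeasurable
    (((m γ₁).add (m γ₂)).add (hcos.mul (m γ₃)))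

lemma intervalIntegrable_speed (h₁ : PC1 γ₁) (h₂ : PC1 γ₂) (h₃ : PC1 γ₃) :
    IntervalIntegrable (speed Δ γ₁ γ₂ γ₃) volume 0 1 := by
  obtain ⟨S, hS, C, hC⟩ := exists_finite_differentiableAt_speed_bound (Δ := Δ) h₁ h₂ h₃
  rw [intervalIntegrable_iff_integrableOn_Ioo_of_le zero_le_one]
  refine IntegrableOn.of_bound measure_Ioo_lt_top (h₁.aestronglyMeasurable_speed h₂) C ?_
  rw [ae_restrict_iff' measurableSet_Ioo]
  have hae : ∀ᵐ x ∂(volume : Measure ℝ), x ∉ S := hS.countable.ae_notMem volume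
  filter_upwards [hae] with x hxS hx
  rw [Real.norm_of_nonneg (speed_nonneg _ _ _ _ _)]
  exact (hC x ⟨hx, hxS⟩).2.2.2

/-- Calibration estimate: a function along the curve whose derivative is dominated by the speed
increases at most by the length. -/
lemma sub_le_integral_speed (h₁ : PC1 γ₁) (h₂ : PC1 γ₂) (h₃ : PC1 γ₃) {W : ℝ → ℝ}
    (hW : ContinuousOn W (Icc 0 1))
    (hd : ∀ x ∈ Ioo (0:ℝ) 1, DifferentiableAt ℝ γ₁ x → DifferentiableAt ℝ γ₂ x →
      DifferentiableAt ℝ γ₃ x → ∃ w, HasDerivAt W w x ∧ |w| ≤ speed Δ γ₁ γ₂ γ₃ x)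
    {s t : ℝ} (hs : 0 ≤ s) (hst : s ≤ t) (ht : t ≤ 1) :
    W t - W s ≤ ∫ x in s..t, speed Δ γ₁ γ₂ γ₃ x := by
  obtain ⟨S, hS, C, hC⟩ := exists_finite_differentiableAt_speed_bound (Δ := Δ) h₁ h₂ h₃
  have hint : IntervalIntegrable (speed Δ γ₁ γ₂ γ₃) volume s t :=
    (intervalIntegrable_speed h₁ h₂ h₃).mono_set (by
      rw [uIcc_of_le hst, uIcc_of_le zero_le_one]; exact Icc_subset_Icc hs ht)
  have hsub : Ioo s t ⊆ Ioo (0:ℝ) 1 := Ioo_subset_Ioo hs ht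
  have hder : ∀ x ∈ Ioo s t \ S, HasDerivAt W (deriv W x) x ∧
      |deriv W x| ≤ speed Δ γ₁ γ₂ γ₃ x := by
    rintro x ⟨hx, hxS⟩
    obtain ⟨d₁, d₂, d₃, -⟩ := hC x ⟨hsub hx, hxS⟩
    obtain ⟨w, hw, hle⟩ := hd x (hsub hx) d₁ d₂ d₃
    rw [hw.deriv]
    exact ⟨hw, hle⟩
  have hae : ∀ᵐ x ∂(volume.restrict (Ioo s t)), |deriv W x| ≤ speed Δ γ₁ γ₂ γ₃ x := by
    rw [ae_restrict_iff' measurableSet_Ioo]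
    filter_upwards [hS.countable.ae_notMem volume] with x hxS hx
    exact (hder x ⟨hx, hxS⟩).2
  have hWint : IntervalIntegrable (deriv W) volume s t := by
    rw [intervalIntegrable_iff_integrableOn_Ioo_of_le hst] at hint ⊢
    exact hint.mono' (measurable_deriv W).aestronglyMeasurable hae
  rw [← integral_eq_of_hasDerivAt_off_countable_of_le W (deriv W) hst hS.countable
    (hW.mono (Icc_subset_Icc hs ht)) (fun x hx => (hder x hx).1) hWint]
  rw [intervalIntegral.integral_of_le hst, intervalIntegral.integral_of_le hst,
    integral_Ioc_eq_integral_Ioo, integral_Ioc_eq_integral_Ioo]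
  rw [intervalIntegrable_iff_integrableOn_Ioo_of_le hst] at hint hWint
  refine integral_mono_ae hWint hint ?_
  filter_upwards [hae] with x hx
  exact (le_abs_self _).trans hx

end Curve

lemma sq_dot_le (a b c p q s : ℝ) :
    (a * p + b * q + c * s) ^ 2 ≤ (a ^ 2 + b ^ 2 + c ^ 2) * (p ^ 2 + q ^ 2 + s ^ 2) := by
  nlinarith [sq_nonneg (a * q - b * p), sq_nonneg (a * s - c * p), sq_nonneg (b * s - c * q)]

lemma dist_pt2 (x y u v : ℝ) : dist (pt2 x y) (pt2 u v) = √((x - u) ^ 2 + (y - v) ^ 2) := by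
  rw [EuclideanSpace.dist_eq]
  simp [pt2, Real.dist_eq, sq_abs]

/-- A product with a continuous factor and a differentiable factor vanishing at the point. -/
lemma hasDerivAt_mul_of_eq_zero {g l : ℝ → ℝ} {l' t : ℝ} (hg : ContinuousAt g t)
    (hl : HasDerivAt l l' t) (h0 : l t = 0) :
    HasDerivAt (fun s => g s * l s) (g t * l') t := by
  rw [hasDerivAt_iff_tendsto_slope] at hl ⊢
  have hg' := hg.tendsto.mono_left (nhdsWithin_le_nhds (s := {t}ᶜ))
  refine (hg'.mul hl).congr fun s => ?_
  simp only [slope_def_field, h0]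
  ring

lemma cos_eq_one_sub_sinc_sq (r : ℝ) : cos r = 1 - (sinc (r / 2) ^ 2 / 2) * r ^ 2 := by
  by_cases hr : r = 0
  · simp [hr]
  · have h2 := Real.cos_sq_add_sin_sq (r / 2)
    have h3 := Real.cos_two_mul (r / 2)
    rw [show 2 * (r / 2) = r by ring] at h3
    rw [sinc_of_ne_zero (by positivity)]
    field_simp
    linear_combination h3 + 2 * h2

/-- The coordinate function, in the direction of a unit vector, of the map
`(p, z) ↦ (sinc ‖p‖ • p, cos ‖p‖ • e^{iz})` into the round `3`-sphere has differential bounded by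
that of the distance function on the sphere. -/
lemma hasDerivAt_sphere_coord {x y z : ℝ → ℝ} {x' y' z' t α β κ : ℝ}
    (hx : HasDerivAt x x' t) (hy : HasDerivAt y y' t) (hz : HasDerivAt z z' t)
    (hunit : α ^ 2 + β ^ 2 + κ ^ 2 = 1) :
    ∃ v, HasDerivAt (fun s => sinc √(x s ^ 2 + y s ^ 2) * (α * x s + β * y s) +
        κ * (cos √(x s ^ 2 + y s ^ 2) * sin (z s))) v t ∧
      v ^ 2 ≤ (1 - (sinc √(x t ^ 2 + y t ^ 2) * (α * x t + β * y t) +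
        κ * (cos √(x t ^ 2 + y t ^ 2) * sin (z t))) ^ 2) *
        (x' ^ 2 + y' ^ 2 + cos √(x t ^ 2 + y t ^ 2) ^ 2 * z' ^ 2) := by
  have hl : HasDerivAt (fun s => α * x s + β * y s) (α * x' + β * y') t :=
    (hx.const_mul α).add (hy.const_mul β)
  have hu : HasDerivAt (fun s => x s ^ 2 + y s ^ 2) (2 * x t * x' + 2 * y t * y') t := by
    exact ((hx.pow 2).add (hy.pow 2)).congr_deriv (by norm_num)
  have hz2 := Real.sin_sq_add_cos_sq (z t)
  by_cases h0 : x t ^ 2 + y t ^ 2 = 0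
  · have hx0 : x t = 0 := by nlinarith [sq_nonneg (x t), sq_nonneg (y t)]
    have hy0 : y t = 0 := by nlinarith [sq_nonneg (x t), sq_nonneg (y t)]
    have hr : ContinuousAt (fun s => √(x s ^ 2 + y s ^ 2)) t := hu.continuousAt.sqrt
    have d1 := hasDerivAt_mul_of_eq_zero
      (g := fun s => sinc √(x s ^ 2 + y s ^ 2))
      (continuous_sinc.continuousAt.comp hr) hl (by simp [hx0, hy0])
    have d2 := hasDerivAt_mul_of_eq_zero
      (g := fun s => sinc (√(x s ^ 2 + y s ^ 2) / 2) ^ 2 / 2)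
      (((continuous_sinc.continuousAt.comp (hr.div_const 2)).pow 2).div_const 2) hu h0
    have d3 : HasDerivAt (fun s => cos √(x s ^ 2 + y s ^ 2)) 0 t := by
      have e : (fun s => cos √(x s ^ 2 + y s ^ 2)) = fun s =>
          1 - (sinc (√(x s ^ 2 + y s ^ 2) / 2) ^ 2 / 2) * (x s ^ 2 + y s ^ 2) := by
        funext s
        rw [cos_eq_one_sub_sinc_sq, Real.sq_sqrt (by positivity)]
      rw [e]
      simpa [hx0, hy0] using d2.const_sub 1
    refine ⟨_, d1.add ((d3.mul hz.sin).const_mul κ), ?_⟩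
    have := sq_dot_le α β (κ * cos (z t)) x' y' z'
    have e : 1 - (κ * sin (z t)) ^ 2 = α ^ 2 + β ^ 2 + (κ * cos (z t)) ^ 2 := by
      linear_combination -hunit - κ ^ 2 * hz2
    simp only [hx0, hy0]
    norm_num
    rw [e]
    convert this using 2
    ring
  · have hpos : 0 < x t ^ 2 + y t ^ 2 := lt_of_le_of_ne (by positivity) (Ne.symm h0)
    have hr := hu.sqrt h0
    set r := √(x t ^ 2 + y t ^ 2) with hrdef
    have hrpos : 0 < r := Real.sqrt_pos.mpr hpos
    have hr2 : r ^ 2 = x t ^ 2 + y t ^ 2 := Real.sq_sqrt hpos.le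
    have hsinc : (fun s => sinc √(x s ^ 2 + y s ^ 2)) =ᶠ[nhds t]
        fun s => sin √(x s ^ 2 + y s ^ 2) / √(x s ^ 2 + y s ^ 2) := by
      filter_upwards [hr.continuousAt.eventually_ne hrpos.ne'] with s hs
      exact sinc_of_ne_zero hs
    have d1 := (hr.sin.div hr hrpos.ne').congr_of_eventuallyEq hsinc
    refine ⟨_, (d1.mul hl).add ((hr.cos.mul hz.sin).const_mul κ), ?_⟩
    rw [sinc_of_ne_zero hrpos.ne']
    have hr1 := Real.sin_sq_add_cos_sq r
    simp only [← hrdef]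
    set S := sin r
    set K := cos r
    set A := (α * x t + β * y t) / r with hA
    set B := (β * x t - α * y t) / r with hB
    set ρ := (x t * x' + y t * y') / r with hρ
    set τ := (x t * y' - y t * x') / r with hτ
    have hAB : A ^ 2 + B ^ 2 = α ^ 2 + β ^ 2 := by
      rw [hA, hB]
      field_simp
      rw [hr2]
      ring
    have hρτ : ρ ^ 2 + τ ^ 2 = x' ^ 2 + y' ^ 2 := by
      rw [hρ, hτ]
      field_simp
      rw [hr2]
      ring
    have hl' : α * x' + β * y' = A * ρ + B * τ := by
      rw [hA, hB, hρ, hτ]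
      field_simp
      rw [hr2]
      ring
    have hA' : α * x t + β * y t = A * r := by rw [hA]; field_simp
    have hρ' : (2 * x t * x' + 2 * y t * y') / (2 * r) = ρ := by rw [hρ]; field_simp
    have hsq : (S / r) ^ 2 ≤ 1 := by
      have := abs_sinc_le_one r
      rw [sinc_of_ne_zero hrpos.ne'] at this
      exact (sq_le_one_iff_abs_le_one _).mpr this
    have hV : 1 - (S / r * (α * x t + β * y t) + κ * (K * sin (z t))) ^ 2 =
        (A * K - κ * sin (z t) * S) ^ 2 + B ^ 2 + (κ * cos (z t)) ^ 2 := by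
      have : S / r * (α * x t + β * y t) = A * S := by rw [hA']; field_simp
      rw [this]
      linear_combination -hunit - hAB - κ ^ 2 * hz2 -
        (A ^ 2 + (κ * sin (z t)) ^ 2) * hr1
    have hc := sq_dot_le (A * K - κ * sin (z t) * S) B (κ * cos (z t)) ρ (S / r * τ) (K * z')
    rw [hV, hρ', hl', hA']
    have hle : ρ ^ 2 + (S / r * τ) ^ 2 + (K * z') ^ 2 ≤ x' ^ 2 + y' ^ 2 + K ^ 2 * z' ^ 2 := by
      rw [← hρτ, mul_pow, mul_pow]
      nlinarith [sq_nonneg τ]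
    refine le_trans (le_of_eq ?_) (hc.trans (mul_le_mul_of_nonneg_left hle (by positivity)))
    congr 1
    field_simp
    ring

/-- A function which is as steep as `arcsin` on `[-1/2, 1/2]` and nowhere steeper. -/
lemma exists_arcsin_calibration : ∃ G : ℝ → ℝ,
    (∀ v, ∃ k, HasDerivAt G k v ∧ 0 ≤ k ∧ k * √(1 - v ^ 2) ≤ 1) ∧
    G (1 / 2) - G (-(1 / 2)) = π / 3 := by
  have hs3 : 0 < √3 / 2 := by positivity
  let k : ℝ → ℝ := fun x => 1 / max √(1 - x ^ 2) (√3 / 2)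
  have hkpos : ∀ x, 0 < max √(1 - x ^ 2) (√3 / 2) := fun x => lt_max_of_lt_right hs3
  have hk : Continuous k := by
    refine continuous_const.div ?_ fun x => (hkpos x).ne'
    fun_prop
  refine ⟨fun v => ∫ x in (0:ℝ)..v, k x, fun v => ⟨k v, ?_, ?_, ?_⟩, ?_⟩
  · exact (hk.integral_hasStrictDerivAt 0 v).hasDerivAt
  · exact one_div_nonneg.mpr (hkpos v).le
  · change 1 / max √(1 - v ^ 2) (√3 / 2) * √(1 - v ^ 2) ≤ 1
    rw [div_mul_eq_mul_div, one_mul, div_le_one (hkpos v)]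
    exact le_max_left _ _
  · change (∫ x in (0:ℝ)..(1 / 2), k x) - ∫ x in (0:ℝ)..(-(1 / 2)), k x = π / 3
    rw [intervalIntegral.integral_interval_sub_left (hk.intervalIntegrable _ _)
      (hk.intervalIntegrable _ _)]
    have harc : arcsin (1 / 2) = π / 6 := by
      rw [← Real.sin_pi_div_six]
      exact Real.arcsin_sin (by linarith [pi_pos]) (by linarith [pi_pos])
    have hd : ∀ x ∈ uIcc (-(1 / 2) : ℝ) (1 / 2), HasDerivAt arcsin (k x) x := by
      intro x hx
      rw [uIcc_of_le (by norm_num)] at hx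
      have hk' : k x = 1 / √(1 - x ^ 2) := by
        have : √3 / 2 ≤ √(1 - x ^ 2) := by
          apply Real.le_sqrt_of_sq_le
          rw [div_pow, Real.sq_sqrt (by norm_num)]
          nlinarith [hx.1, hx.2]
        simp only [k, max_eq_left this]
      rw [hk']
      exact Real.hasDerivAt_arcsin (by linarith [hx.1]) (by linarith [hx.2])
    rw [intervalIntegral.integral_eq_sub_of_hasDerivAt hd (hk.intervalIntegrable _ _),
      Real.arcsin_neg, harc]
    ring

section LengthBounds

variable {Δ : Set (EuclideanSpace ℝ (Fin 2))} {γ₁ γ₂ γ₃ : ℝ → ℝ}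

lemma horizontal_linear_le_integral_speed (h₁ : PC1 γ₁) (h₂ : PC1 γ₂) (h₃ : PC1 γ₃) {α β : ℝ}
    (hαβ : α ^ 2 + β ^ 2 ≤ 1) {s t : ℝ} (hs : 0 ≤ s) (hst : s ≤ t) (ht : t ≤ 1) :
    α * (γ₁ t - γ₁ s) + β * (γ₂ t - γ₂ s) ≤ ∫ x in s..t, speed Δ γ₁ γ₂ γ₃ x := by
  have := sub_le_integral_speed (Δ := Δ) h₁ h₂ h₃ (W := fun x => α * γ₁ x + β * γ₂ x)
    ((continuousOn_const.mul h₁.continuousOn).add (continuousOn_const.mul h₂.continuousOn))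
    (fun x _ d₁ d₂ _ => ⟨_, (d₁.hasDerivAt.const_mul α).add (d₂.hasDerivAt.const_mul β), by
      refine Real.abs_le_sqrt ?_
      nlinarith [sq_nonneg (α * deriv γ₂ x - β * deriv γ₁ x),
        sq_nonneg (cos (Metric.infDist (pt2 (γ₁ x) (γ₂ x)) Δ) * deriv γ₃ x),
        mul_nonneg (sub_nonneg.mpr hαβ) (add_nonneg (sq_nonneg (deriv γ₁ x))
          (sq_nonneg (deriv γ₂ x)))]⟩) hs hst ht
  linarith

lemma horizontal_dist_le_integral_speed (h₁ : PC1 γ₁) (h₂ : PC1 γ₂) (h₃ : PC1 γ₃)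
    {s t : ℝ} (hs : 0 ≤ s) (hst : s ≤ t) (ht : t ≤ 1) :
    √((γ₁ t - γ₁ s) ^ 2 + (γ₂ t - γ₂ s) ^ 2) ≤ ∫ x in s..t, speed Δ γ₁ γ₂ γ₃ x := by
  set L := √((γ₁ t - γ₁ s) ^ 2 + (γ₂ t - γ₂ s) ^ 2) with hL
  have hL2 : L ^ 2 = (γ₁ t - γ₁ s) ^ 2 + (γ₂ t - γ₂ s) ^ 2 := Real.sq_sqrt (by positivity)
  rcases (Real.sqrt_nonneg _ : 0 ≤ L).eq_or_lt with h0 | hpos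
  · rw [hL, ← h0]
    exact intervalIntegral.integral_nonneg hst fun x _ => speed_nonneg _ _ _ _ x
  · have := horizontal_linear_le_integral_speed (Δ := Δ) h₁ h₂ h₃
      (α := (γ₁ t - γ₁ s) / L) (β := (γ₂ t - γ₂ s) / L)
      (by rw [div_pow, div_pow, ← add_div, ← hL2, div_self (by positivity)]) hs hst ht
    refine le_of_eq_of_le ?_ this
    rw [div_mul_eq_mul_div, div_mul_eq_mul_div, ← add_div, eq_div_iff hpos.ne']
    linarith

lemma horizontal_dist_le_sLen (h₁ : PC1 γ₁) (h₂ : PC1 γ₂) (h₃ : PC1 γ₃) :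
    √((γ₁ 1 - γ₁ 0) ^ 2 + (γ₂ 1 - γ₂ 0) ^ 2) ≤ sLen Δ γ₁ γ₂ γ₃ :=
  horizontal_dist_le_integral_speed h₁ h₂ h₃ le_rfl zero_le_one le_rfl

lemma vertical_displacement_le_sLen (h₁ : PC1 γ₁) (h₂ : PC1 γ₂) (h₃ : PC1 γ₃)
    (hcover : ∀ x y, Metric.infDist (pt2 x y) Δ ≤ π / 3) :
    |γ₃ 1 - γ₃ 0| / 2 ≤ sLen Δ γ₁ γ₂ γ₃ := by
  have key : ∀ ε : ℝ, ε ^ 2 = 1 → ε * (γ₃ 1 - γ₃ 0) / 2 ≤ sLen Δ γ₁ γ₂ γ₃ := by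
    intro ε hε
    have := sub_le_integral_speed (Δ := Δ) h₁ h₂ h₃ (W := fun x => ε / 2 * γ₃ x)
      (continuousOn_const.mul h₃.continuousOn)
      (fun x _ _ _ d₃ => ⟨_, d₃.hasDerivAt.const_mul (ε / 2), by
        refine Real.abs_le_sqrt ?_
        have hc : (1 / 2 : ℝ) ≤ cos (Metric.infDist (pt2 (γ₁ x) (γ₂ x)) Δ) := by
          rw [← Real.cos_pi_div_three]
          exact Real.cos_le_cos_of_nonneg_of_le_pi Metric.infDist_nonneg
            (by linarith [pi_pos]) (hcover _ _)
        rw [mul_pow, div_pow, hε]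
        nlinarith [sq_nonneg (deriv γ₁ x), sq_nonneg (deriv γ₂ x),
          mul_le_mul_of_nonneg_right (pow_le_pow_left₀ (by norm_num) hc 2)
            (sq_nonneg (deriv γ₃ x))]⟩) le_rfl zero_le_one le_rfl
    rw [sLen_eq_integral_speed]
    linarith
  rcases abs_choice (γ₃ 1 - γ₃ 0) with h | h <;> rw [h]
  · simpa using key 1 (by norm_num)
  · simpa using key (-1) (by norm_num)

/-- A curve joining two points at the same distance `r` from a lattice point `c`, whose horizontal
displacement has norm `r` as well and whose vertical displacement is `±π/3`, has length at least
`π/3`. -/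
lemma pi_div_three_le_sLen_of_screw (h₁ : PC1 γ₁) (h₂ : PC1 γ₂) (h₃ : PC1 γ₃) {a b : ℝ}
    (hc : pt2 a b ∈ Δ)
    (hr : (γ₁ 1 - a) ^ 2 + (γ₂ 1 - b) ^ 2 = (γ₁ 0 - a) ^ 2 + (γ₂ 0 - b) ^ 2)
    (hp : (γ₁ 1 - γ₁ 0) ^ 2 + (γ₂ 1 - γ₂ 0) ^ 2 = (γ₁ 0 - a) ^ 2 + (γ₂ 0 - b) ^ 2)
    (hz : |γ₃ 1 - γ₃ 0| = π / 3) :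
    π / 3 ≤ sLen Δ γ₁ γ₂ γ₃ := by
  set r : ℝ → ℝ := fun t => √((γ₁ t - a) ^ 2 + (γ₂ t - b) ^ 2) with hrdef
  have hrsq : ∀ t, r t ^ 2 = (γ₁ t - a) ^ 2 + (γ₂ t - b) ^ 2 := fun t =>
    Real.sq_sqrt (by positivity)
  have hr0 : ∀ t, 0 ≤ r t := fun t => Real.sqrt_nonneg _
  have hr10 : r 1 = r 0 := by simp only [hrdef, hr]
  have hlen := horizontal_dist_le_sLen (Δ := Δ) h₁ h₂ h₃
  rw [hp] at hlen
  change r 0 ≤ _ at hlen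
  by_cases hbig : π / 3 ≤ r 0
  · exact hbig.trans hlen
  push Not at hbig
  by_cases hexit : ∃ t ∈ Icc (0:ℝ) 1, π / 2 ≤ r t
  · obtain ⟨t, ht, hrt⟩ := hexit
    have hrpos : 0 < r t := lt_of_lt_of_le (by positivity) hrt
    set α := (γ₁ t - a) / r t with hα
    set β := (γ₂ t - b) / r t with hβ
    have hαβ : α ^ 2 + β ^ 2 = 1 := by
      rw [hα, hβ, div_pow, div_pow, ← add_div, ← hrsq, div_self (by positivity)]
    have hdot : α * (γ₁ t - a) + β * (γ₂ t - b) = r t := by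
      rw [hα, hβ]
      field_simp
      exact (hrsq t).symm
    have hCS : ∀ s, α * (γ₁ s - a) + β * (γ₂ s - b) ≤ r s := fun s =>
      Real.le_sqrt_of_sq_le (by
        nlinarith [sq_nonneg (α * (γ₂ s - b) - β * (γ₁ s - a))])
    have e1 := horizontal_linear_le_integral_speed (Δ := Δ) h₁ h₂ h₃ hαβ.le le_rfl ht.1 ht.2
    have e2 := horizontal_linear_le_integral_speed (Δ := Δ) h₁ h₂ h₃
      (α := -α) (β := -β) (by rw [neg_sq, neg_sq]; exact hαβ.le) ht.1 ht.2 le_rfl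
    have hint := intervalIntegrable_speed (Δ := Δ) h₁ h₂ h₃
    have hi1 : IntervalIntegrable (speed Δ γ₁ γ₂ γ₃) volume 0 t := hint.mono_set (by
      rw [uIcc_of_le ht.1, uIcc_of_le zero_le_one]; exact Icc_subset_Icc le_rfl ht.2)
    have hi2 : IntervalIntegrable (speed Δ γ₁ γ₂ γ₃) volume t 1 := hint.mono_set (by
      rw [uIcc_of_le ht.2, uIcc_of_le zero_le_one]; exact Icc_subset_Icc ht.1 le_rfl)
    rw [sLen_eq_integral_speed, ← intervalIntegral.integral_add_adjacent_intervals hi1 hi2]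
    have c0 := hCS 0
    have c1 := hCS 1
    rw [hr10] at c1
    linarith
  push Not at hexit
  obtain ⟨G, hG, hGval⟩ := exists_arcsin_calibration
  obtain ⟨σ, hσ, hσz⟩ : ∃ σ : ℝ, σ ^ 2 = 1 ∧ γ₃ 1 - γ₃ 0 = σ * (π / 3) := by
    rcases abs_choice (γ₃ 1 - γ₃ 0) with h | h
    · exact ⟨1, by norm_num, by linarith⟩
    · exact ⟨-1, by norm_num, by linarith⟩
  set m := (γ₃ 0 + γ₃ 1) / 2 with hm
  set α := sinc (r 0) * (γ₁ 1 - γ₁ 0) with hα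
  set β := sinc (r 0) * (γ₂ 1 - γ₂ 0) with hβ
  set κ := σ * cos (r 0) with hκ
  have hsr : (sinc (r 0) * r 0) ^ 2 = sin (r 0) ^ 2 := by
    by_cases h : r 0 = 0
    · simp [h]
    · rw [sinc_of_ne_zero h, div_mul_cancel₀ _ h]
  have hunit : α ^ 2 + β ^ 2 + κ ^ 2 = 1 := by
    have : (sinc (r 0) * r 0) ^ 2 = α ^ 2 + β ^ 2 := by
      rw [mul_pow, hrsq, ← hp, hα, hβ]
      ring
    rw [← this, hsr, hκ, mul_pow, hσ]
    linear_combination Real.sin_sq_add_cos_sq (r 0)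
  set V : ℝ → ℝ := fun t => sinc (r t) * (α * (γ₁ t - a) + β * (γ₂ t - b)) +
    κ * (cos (r t) * sin (γ₃ t - m)) with hV
  have c₁ := h₁.continuousOn
  have c₂ := h₂.continuousOn
  have c₃ := h₃.continuousOn
  have hrc : ContinuousOn r (Icc 0 1) :=
    (((c₁.sub continuousOn_const).pow 2).add ((c₂.sub continuousOn_const).pow 2)).sqrt
  have hVc : ContinuousOn V (Icc 0 1) :=
    ((continuous_sinc.comp_continuousOn hrc).mul
      ((continuousOn_const.mul (c₁.sub continuousOn_const)).add
        (continuousOn_const.mul (c₂.sub continuousOn_const)))).add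
      (continuousOn_const.mul ((Real.continuous_cos.comp_continuousOn hrc).mul
        (Real.continuous_sin.comp_continuousOn (c₃.sub continuousOn_const))))
  have hGc : Continuous G := continuous_iff_continuousAt.mpr fun v => by
    obtain ⟨k, hk, -⟩ := hG v
    exact hk.continuousAt
  have hmain := sub_le_integral_speed (Δ := Δ) h₁ h₂ h₃ (W := fun t => G (V t))
    (hGc.comp_continuousOn hVc) (by
      intro t ht d₁ d₂ d₃
      obtain ⟨v, hv, hvle⟩ := hasDerivAt_sphere_coord (d₁.hasDerivAt.sub_const a)
        (d₂.hasDerivAt.sub_const b) (d₃.hasDerivAt.sub_const m) hunit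
      obtain ⟨k, hk, hk0, hk1⟩ := hG (V t)
      refine ⟨k * v, hk.comp t hv, ?_⟩
      change v ^ 2 ≤ (1 - V t ^ 2) *
        (deriv γ₁ t ^ 2 + deriv γ₂ t ^ 2 + cos (r t) ^ 2 * deriv γ₃ t ^ 2) at hvle
      have hdle : Metric.infDist (pt2 (γ₁ t) (γ₂ t)) Δ ≤ r t := by
        refine (Metric.infDist_le_dist_of_mem hc).trans (le_of_eq ?_)
        rw [dist_pt2]
      have hrt := hexit t (Ioo_subset_Icc_self ht)
      have hcos : cos (r t) ≤ cos (Metric.infDist (pt2 (γ₁ t) (γ₂ t)) Δ) :=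
        Real.cos_le_cos_of_nonneg_of_le_pi Metric.infDist_nonneg (by linarith [pi_pos]) hdle
      have hcos0 : 0 ≤ cos (r t) := Real.cos_nonneg_of_neg_pi_div_two_le_of_le
        (by linarith [hr0 t, pi_pos]) hrt.le
      have hle : √(deriv γ₁ t ^ 2 + deriv γ₂ t ^ 2 + cos (r t) ^ 2 * deriv γ₃ t ^ 2) ≤
          speed Δ γ₁ γ₂ γ₃ t := by
        refine Real.sqrt_le_sqrt ?_
        gcongr
      have hvabs : |v| ≤ √(1 - V t ^ 2) *
          √(deriv γ₁ t ^ 2 + deriv γ₂ t ^ 2 + cos (r t) ^ 2 * deriv γ₃ t ^ 2) := by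
        rw [← Real.sqrt_mul' _ (by positivity)]
        exact Real.abs_le_sqrt hvle
      rw [abs_mul, abs_of_nonneg hk0]
      calc k * |v| ≤ k * (√(1 - V t ^ 2) * speed Δ γ₁ γ₂ γ₃ t) := by
            gcongr
            exact hvabs.trans (by gcongr)
        _ = k * √(1 - V t ^ 2) * speed Δ γ₁ γ₂ γ₃ t := by ring
        _ ≤ 1 * speed Δ γ₁ γ₂ γ₃ t := by
            gcongr
            exact speed_nonneg _ _ _ _ _
        _ = _ := one_mul _) le_rfl zero_le_one le_rfl
  rw [sLen_eq_integral_speed]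
  have hsq := Real.sin_sq_add_cos_sq (r 0)
  have hsr2 : sinc (r 0) ^ 2 * ((γ₁ 0 - a) ^ 2 + (γ₂ 0 - b) ^ 2) = sin (r 0) ^ 2 := by
    rw [← hrsq, ← mul_pow, hsr]
  have hsin : ∀ τ : ℝ, sin (σ * τ) = σ * sin τ := by
    intro τ
    rcases eq_or_eq_neg_of_sq_eq_sq σ 1 (by rw [hσ, one_pow]) with h | h <;> simp [h]
  have hV1 : V 1 = 1 / 2 := by
    have e : γ₃ 1 - m = σ * (π / 6) := by rw [hm]; linarith
    simp only [hV, hr10, e, hsin, Real.sin_pi_div_six, hα, hβ, hκ]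
    linear_combination (1 / 2) * hsq + (1 / 2) * hsr2 + (cos (r 0) ^ 2 / 2) * hσ +
      (sinc (r 0) ^ 2 / 2) * (hp + hr)
  have hV0 : V 0 = -(1 / 2) := by
    have e : γ₃ 0 - m = σ * (-(π / 6)) := by rw [hm]; linarith
    simp only [hV, e, hsin, Real.sin_neg, Real.sin_pi_div_six, hα, hβ, hκ]
    linear_combination -(1 / 2) * hsq - (1 / 2) * hsr2 - (cos (r 0) ^ 2 / 2) * hσ -
      (sinc (r 0) ^ 2 / 2) * (hp - hr)
  simp only [hV1, hV0, hGval] at hmain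
  exact hmain

end LengthBounds

lemma infDist_hexagonal_lattice_le (x y : ℝ) :
    Metric.infDist (pt2 x y) (ΔhexE (π / 12)) ≤ π / 3 := by
  have ha : 0 < π / 12 := by positivity
  have hs : 0 < √3 := by positivity
  have hs2 : √3 ^ 2 = 3 := Real.sq_sqrt (by norm_num)
  set a := π / 12 with hadef
  set n := round (y / (a * √3)) with hn
  set m := round ((x - a * n) / (2 * a)) with hm
  have e1 := abs_le.mp (abs_sub_round (y / (a * √3)))
  have e2 := abs_le.mp (abs_sub_round ((x - a * n) / (2 * a)))
  rw [← hn] at e1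
  rw [← hm] at e2
  set u := y / (a * √3) - n with hu
  set v := (x - a * n) / (2 * a) - m with hv
  have hy : y - a * √3 * n = a * √3 * u := by
    rw [hu]
    field_simp
  have hx : x - (2 * a * m + a * n) = 2 * a * v := by
    rw [hv]
    field_simp
    ring
  have hmem : pt2 (2 * a * m + a * n) (a * √3 * n) ∈ ΔhexE a := ⟨m, n, rfl⟩
  refine (Metric.infDist_le_dist_of_mem hmem).trans ?_
  rw [dist_pt2, hx, hy]
  apply Real.sqrt_le_iff.mpr
  refine ⟨by positivity, ?_⟩
  have h4 : π / 3 = 4 * a := by rw [hadef]; ring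
  have hu2 : u ^ 2 ≤ 1 := by nlinarith
  have hv2 : v ^ 2 ≤ 1 := by nlinarith
  rw [h4, mul_pow, mul_pow, mul_pow, mul_pow, hs2]
  nlinarith [mul_le_mul_of_nonneg_left hu2 (sq_nonneg a),
    mul_le_mul_of_nonneg_left hv2 (sq_nonneg a)]

/-- Every element of `Γ₆` is a screw motion by an integer multiple of `π/3`, followed by a
horizontal translation in the lattice `2Δ_hex(π/12)`. -/
lemma exists_screw_of_mem_Γ₆ {g : Equiv.Perm (ℝ × ℝ × ℝ)} (hg : g ∈ Γ₆) :
    ∃ k m n : ℤ, ∀ x y z : ℝ, g (x, y, z) =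
      (cos (k * (π / 3)) * x - sin (k * (π / 3)) * y + (4 * (π / 12) * m + 2 * (π / 12) * n),
        sin (k * (π / 3)) * x + cos (k * (π / 3)) * y + 2 * (π / 12) * √3 * n,
        z + k * (π / 3)) := by
  have hs2 : √3 ^ 2 = 3 := Real.sq_sqrt (by norm_num)
  have htrans : ∀ (y : Equiv.Perm (ℝ × ℝ × ℝ)) (k₁ k₂ k₃ k m n : ℤ),
      (∀ x y' z : ℝ, y (x, y', z) =
        (cos (k * (π / 3)) * x - sin (k * (π / 3)) * y' + (4 * (π / 12) * m + 2 * (π / 12) * n),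
          sin (k * (π / 3)) * x + cos (k * (π / 3)) * y' + 2 * (π / 12) * √3 * n,
          z + k * (π / 3))) →
      ∀ x y' z : ℝ, ((4 * (π / 12) * k₁ + 2 * (π / 12) * k₂, 2 * (π / 12) * √3 * k₂,
          2 * π * k₃) : ℝ × ℝ × ℝ) + y (x, y', z) =
        (cos ((k + 6 * k₃ : ℤ) * (π / 3)) * x - sin ((k + 6 * k₃ : ℤ) * (π / 3)) * y' +
            (4 * (π / 12) * (m + k₁ : ℤ) + 2 * (π / 12) * (n + k₂ : ℤ)),
          sin ((k + 6 * k₃ : ℤ) * (π / 3)) * x + cos ((k + 6 * k₃ : ℤ) * (π / 3)) * y' +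
            2 * (π / 12) * √3 * (n + k₂ : ℤ),
          z + (k + 6 * k₃ : ℤ) * (π / 3)) := by
    intro y k₁ k₂ k₃ k m n h x y' z
    have e : ((k + 6 * k₃ : ℤ) : ℝ) * (π / 3) = k * (π / 3) + k₃ * (2 * π) := by
      push_cast
      ring
    rw [h, e, Real.cos_add_int_mul_two_pi, Real.sin_add_int_mul_two_pi]
    push_cast
    simp only [Prod.mk_add_mk, Prod.mk.injEq]
    exact ⟨by ring, by ring, by ring⟩
  refine Subgroup.closure_induction_left (p := fun g _ => ∃ k m n : ℤ, ∀ x y z : ℝ, g (x, y, z) =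
      (cos (k * (π / 3)) * x - sin (k * (π / 3)) * y + (4 * (π / 12) * m + 2 * (π / 12) * n),
        sin (k * (π / 3)) * x + cos (k * (π / 3)) * y + 2 * (π / 12) * √3 * n,
        z + k * (π / 3))) ?_ ?_ ?_ hg
  · exact ⟨0, 0, 0, fun x y z => by simp⟩
  · rintro x hx y hy ⟨k, m, n, h⟩
    rcases hx with ⟨w, ⟨k₁, k₂, k₃, rfl⟩, rfl⟩ | rfl
    · exact ⟨k + 6 * k₃, m + k₁, n + k₂, htrans y k₁ k₂ k₃ k m n h⟩
    · refine ⟨k + 1, -n, m + n, fun x y' z => ?_⟩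
      have e : ((k + 1 : ℤ) : ℝ) * (π / 3) = k * (π / 3) + π / 3 := by
        push_cast
        ring
      rw [Equiv.Perm.mul_apply, h, e, Real.cos_add, Real.sin_add]
      simp only [phi0Perm, Equiv.coe_fn_mk, Real.cos_pi_div_three, Real.sin_pi_div_three,
        Prod.mk.injEq]
      push_cast
      refine ⟨?_, ?_, ?_⟩
      · linear_combination -(π / 12 * n) * hs2
      · ring
      · ring
  · rintro x hx y hy ⟨k, m, n, h⟩
    rcases hx with ⟨w, ⟨k₁, k₂, k₃, rfl⟩, rfl⟩ | rfl
    · refine ⟨k + 6 * (-k₃), m + (-k₁), n + (-k₂), fun x y' z => ?_⟩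
      rw [← htrans y (-k₁) (-k₂) (-k₃) k m n h]
      rw [Equiv.Perm.mul_apply, Equiv.Perm.inv_eq_iff_eq, Equiv.coe_addLeft]
      beta_reduce
      rw [← add_assoc, right_eq_add]
      push_cast
      simp only [Prod.mk_add_mk, Prod.mk_eq_zero]
      exact ⟨by ring, by ring, by ring⟩
    · refine ⟨k - 1, m + n, -m, fun x y' z => ?_⟩
      have e : ((k - 1 : ℤ) : ℝ) * (π / 3) = k * (π / 3) - π / 3 := by
        push_cast
        ring
      rw [Equiv.Perm.mul_apply, h, e, Real.cos_sub, Real.sin_sub]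
      change phi0Perm.symm _ = _
      simp only [phi0Perm, Equiv.coe_fn_symm_mk, Real.cos_pi_div_three, Real.sin_pi_div_three,
        Prod.mk.injEq]
      push_cast
      refine ⟨?_, ?_, ?_⟩
      · linear_combination (π / 12 * n) * hs2
      · ring
      · ring

/-- Noncontractible loops of the quotient by `Γ₆` have length at least `π/3`. -/
lemma pi_div_three_le_sLen_of_mem_Γ₆ {g : Equiv.Perm (ℝ × ℝ × ℝ)} (hg : g ∈ Γ₆) (hg1 : g ≠ 1)
    {γ₁ γ₂ γ₃ : ℝ → ℝ} (h₁ : PC1 γ₁) (h₂ : PC1 γ₂) (h₃ : PC1 γ₃)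
    (hend : (γ₁ 1, γ₂ 1, γ₃ 1) = g (γ₁ 0, γ₂ 0, γ₃ 0)) :
    π / 3 ≤ sLen (ΔhexE (π / 12)) γ₁ γ₂ γ₃ := by
  have hs2 : √3 ^ 2 = 3 := Real.sq_sqrt (by norm_num)
  have hpi := pi_pos
  obtain ⟨k, m, n, hk⟩ := exists_screw_of_mem_Γ₆ hg
  rw [hk] at hend
  simp only [Prod.mk.injEq] at hend
  obtain ⟨e1, e2, e3⟩ := hend
  by_cases hk2 : 2 ≤ |k|
  · refine le_trans ?_ (vertical_displacement_le_sLen h₁ h₂ h₃ infDist_hexagonal_lattice_le)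
    have : (2 : ℝ) ≤ |(k : ℝ)| := by exact_mod_cast hk2
    rw [e3, add_sub_cancel_left, abs_mul, abs_of_pos (by positivity : 0 < π / 3)]
    nlinarith
  have hk3 : k = 0 ∨ k = 1 ∨ k = -1 := by
    have := abs_lt.mp (not_le.mp hk2)
    omega
  rcases hk3 with rfl | rfl | rfl
  · refine le_trans ?_ (horizontal_dist_le_sLen h₁ h₂ h₃)
    have hmn : m ≠ 0 ∨ n ≠ 0 := by
      by_contra hcon
      push Not at hcon
      obtain ⟨rfl, rfl⟩ := hcon
      refine hg1 (Equiv.ext ?_)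
      rintro ⟨x, y, z⟩
      rw [hk]
      simp
    have hq : (1 : ℝ) ≤ (m : ℝ) ^ 2 + m * n + n ^ 2 := by
      have : 0 < m ^ 2 + m * n + n ^ 2 := by
        rcases hmn with h | h
        · nlinarith [sq_nonneg (m + 2 * n), sq_pos_of_ne_zero h]
        · nlinarith [sq_nonneg (2 * m + n), sq_pos_of_ne_zero h]
      exact_mod_cast this
    apply Real.le_sqrt_of_sq_le
    simp only [Int.cast_zero, zero_mul, cos_zero, sin_zero] at e1 e2
    have e : (γ₁ 1 - γ₁ 0) ^ 2 + (γ₂ 1 - γ₂ 0) ^ 2 =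
        (π / 3) ^ 2 * ((m : ℝ) ^ 2 + m * n + n ^ 2) := by
      rw [e1, e2]
      linear_combination (π ^ 2 / 36 * n ^ 2) * hs2
    rw [e]
    nlinarith [sq_nonneg (π / 3)]
  · refine pi_div_three_le_sLen_of_screw h₁ h₂ h₃
      (a := 2 * (π / 12) * (-2 * n : ℤ) + π / 12 * (2 * m + 2 * n : ℤ))
      (b := π / 12 * √3 * (2 * m + 2 * n : ℤ)) ⟨-2 * n, 2 * m + 2 * n, rfl⟩ ?_ ?_ ?_
    · simp only [Int.cast_one, one_mul, Real.cos_pi_div_three, Real.sin_pi_div_three] at e1 e2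
      rw [e1, e2]
      push_cast
      ring_nf
      simp only [hs2]
      ring
    · simp only [Int.cast_one, one_mul, Real.cos_pi_div_three, Real.sin_pi_div_three] at e1 e2
      rw [e1, e2]
      push_cast
      ring_nf
      simp only [hs2]
      ring
    · rw [e3]
      simp only [Int.cast_one, one_mul, add_sub_cancel_left]
      exact abs_of_pos (by positivity)
  · refine pi_div_three_le_sLen_of_screw h₁ h₂ h₃
      (a := 2 * (π / 12) * (2 * m + 2 * n : ℤ) + π / 12 * (-2 * m : ℤ))
      (b := π / 12 * √3 * (-2 * m : ℤ)) ⟨2 * m + 2 * n, -2 * m, rfl⟩ ?_ ?_ ?_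
    · simp only [Int.cast_neg, Int.cast_one, neg_mul, one_mul, Real.cos_neg, Real.sin_neg,
        Real.cos_pi_div_three, Real.sin_pi_div_three] at e1 e2
      rw [e1, e2]
      push_cast
      ring_nf
      simp only [hs2]
      ring
    · simp only [Int.cast_neg, Int.cast_one, neg_mul, one_mul, Real.cos_neg, Real.sin_neg,
        Real.cos_pi_div_three, Real.sin_pi_div_three] at e1 e2
      rw [e1, e2]
      push_cast
      ring_nf
      simp only [hs2]
      ring
    · rw [e3]
      simp only [Int.cast_one, Int.cast_neg, neg_mul, one_mul, add_sub_cancel_left, abs_neg]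
      exact abs_of_pos (by positivity)

lemma PC1.of_contDiff {f : ℝ → ℝ} (hf : ContDiff ℝ 1 f) : PC1 f :=
  ⟨1, fun i => i, by simp, by simp, fun i _ => by simp, hf.continuous.continuousOn,
    fun _ _ => hf.contDiffOn⟩

/-- The shortest horizontal translation in `Γ₆` is realized by a loop of length `π/3`. -/
lemma exists_loop_sLen_eq : ∃ g ∈ Γ₆, g ≠ 1 ∧ ∃ γ₁ γ₂ γ₃ : ℝ → ℝ,
    PC1 γ₁ ∧ PC1 γ₂ ∧ PC1 γ₃ ∧ (γ₁ 1, γ₂ 1, γ₃ 1) = g (γ₁ 0, γ₂ 0, γ₃ 0) ∧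
    π / 3 = sLen (ΔhexE (π / 12)) γ₁ γ₂ γ₃ := by
  have hpi := pi_pos
  refine ⟨Equiv.addLeft (π / 3, 0, 0), Subgroup.subset_closure (Or.inl ⟨_, ⟨1, 0, 0, ?_⟩, rfl⟩),
    ?_, fun t => π / 3 * t, fun _ => 0, fun _ => 0, PC1.of_contDiff (by fun_prop),
    PC1.of_contDiff contDiff_const, PC1.of_contDiff contDiff_const, ?_, ?_⟩
  · simp only [Prod.mk.injEq]
    norm_num
    ring
  · intro h
    have := congrArg Prod.fst (Equiv.congr_fun h (0, 0, 0))
    simp at this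
  · simp
  · have hd : ∀ t, deriv (fun t : ℝ => π / 3 * t) t = π / 3 := fun t => by simp
    simp only [sLen, hd, deriv_const]
    simp [Real.sqrt_sq (show 0 ≤ π / 3 by positivity)]

/-- The closed hexagon with apothem `a` in coordinates. -/
def hexagon (a : ℝ) : Set (ℝ × ℝ) := {p | |p.1| ≤ a ∧ |p.1| + √3 * |p.2| ≤ 2 * a}

lemma measurableSet_hexagon (a : ℝ) : MeasurableSet (hexagon a) := by
  have h1 : IsClosed {p : ℝ × ℝ | |p.1| ≤ a} := isClosed_le (by fun_prop) (by fun_prop)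
  have h2 : IsClosed {p : ℝ × ℝ | |p.1| + √3 * |p.2| ≤ 2 * a} :=
    isClosed_le (by fun_prop) (by fun_prop)
  exact (h1.inter h2).measurableSet

lemma integral_abs_symm {a : ℝ} (ha : 0 ≤ a) : ∫ x in (-a)..a, |x| = a ^ 2 := by
  have hi : ∀ b c : ℝ, IntervalIntegrable (fun x : ℝ => |x|) volume b c := fun b c =>
    continuous_abs.intervalIntegrable _ _
  rw [← intervalIntegral.integral_add_adjacent_intervals (hi (-a) 0) (hi 0 a)]
  have e1 : ∫ x in (-a)..0, |x| = ∫ x in (-a)..0, -x :=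
    intervalIntegral.integral_congr fun x hx => by
      rw [uIcc_of_le (by linarith)] at hx
      exact abs_of_nonpos hx.2
  have e2 : ∫ x in (0:ℝ)..a, |x| = ∫ x in (0:ℝ)..a, x :=
    intervalIntegral.integral_congr fun x hx => by
      rw [uIcc_of_le ha] at hx
      exact abs_of_nonneg hx.1
  rw [e1, e2, intervalIntegral.integral_neg, integral_id, integral_id]
  ring

lemma volume_hexagon {a : ℝ} (ha : 0 ≤ a) :
    volume (hexagon a) = ENNReal.ofReal (2 * √3 * a ^ 2) := by
  have hs : 0 < √3 := by positivity
  have hs2 : √3 ^ 2 = 3 := Real.sq_sqrt (by norm_num)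
  have hslice : ∀ x : ℝ, volume (Prod.mk x ⁻¹' hexagon a) =
      (Icc (-a) a).indicator (fun x => ENNReal.ofReal (2 * (2 * a - |x|) / √3)) x := by
    intro x
    by_cases hx : x ∈ Icc (-a) a
    · have hxa : |x| ≤ a := abs_le.mpr hx
      have e : Prod.mk x ⁻¹' hexagon a = Icc (-((2 * a - |x|) / √3)) ((2 * a - |x|) / √3) := by
        ext y
        rw [mem_Icc, ← abs_le, le_div_iff₀ hs]
        simp only [hexagon, mem_preimage, mem_ofPred_eq]
        exact ⟨fun h => by linarith [h.2], fun h => ⟨hxa, by linarith⟩⟩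
      rw [indicator_of_mem hx, e, Real.volume_Icc]
      congr 1
      ring
    · have e : Prod.mk x ⁻¹' hexagon a = ∅ := by
        ext y
        simp only [hexagon, mem_preimage, mem_ofPred_eq, mem_empty_iff_false, iff_false, not_and]
        exact fun h => absurd (abs_le.mp h) hx
      rw [indicator_of_notMem hx, e, measure_empty]
  rw [Measure.volume_eq_prod, Measure.prod_apply (measurableSet_hexagon a)]
  simp_rw [hslice]
  rw [lintegral_indicator measurableSet_Icc, ← ofReal_integral_eq_lintegral_ofReal]
  · congr 1
    rw [integral_Icc_eq_integral_Ioc, ← intervalIntegral.integral_of_le (by linarith)]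
    have e : (fun x : ℝ => 2 * (2 * a - |x|) / √3) = fun x => 4 * a / √3 - 2 / √3 * |x| := by
      funext x
      ring
    rw [e, intervalIntegral.integral_sub (by simp)
      ((continuous_abs.intervalIntegrable _ _).const_mul _), intervalIntegral.integral_const,
      intervalIntegral.integral_const_mul, integral_abs_symm ha, smul_eq_mul]
    field_simp
    rw [hs2]
    ring
  · exact (Continuous.continuousOn (by fun_prop)).integrableOn_Icc
  · rw [Filter.EventuallyLE, ae_restrict_iff' measurableSet_Icc]
    refine Filter.Eventually.of_forall fun x hx => ?_
    have := abs_le.mpr hx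
    exact div_nonneg (by linarith) hs.le

lemma norm_sq_euclidean_two (p : EuclideanSpace ℝ (Fin 2)) : ‖p‖ ^ 2 = p 0 ^ 2 + p 1 ^ 2 := by
  rw [EuclideanSpace.norm_sq_eq]
  simp

lemma norm_sub_pt2_sq (p : EuclideanSpace ℝ (Fin 2)) (u v : ℝ) :
    ‖p - pt2 u v‖ ^ 2 = (p 0 - u) ^ 2 + (p 1 - v) ^ 2 := by
  rw [norm_sq_euclidean_two]
  simp [pt2]

lemma isClosed_vorCell (Δ : Set (EuclideanSpace ℝ (Fin 2))) : IsClosed (vorCell Δ) := by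
  simp only [vorCell, ofPred_forall]
  exact isClosed_iInter fun q => isClosed_iInter fun _ =>
    isClosed_le continuous_norm (continuous_id.sub continuous_const).norm

lemma mem_hexagon_of_mem_vorCell {a : ℝ} (ha : 0 < a) {p : EuclideanSpace ℝ (Fin 2)}
    (hp : p ∈ vorCell (ΔhexE a)) : (p 0, p 1) ∈ hexagon a := by
  have hs2 : √3 ^ 2 = 3 := Real.sq_sqrt (by norm_num)
  have key : ∀ m n : ℤ, p 0 * (2 * m + n) + p 1 * (√3 * n) ≤
      a * (2 * (m ^ 2 + m * n + n ^ 2)) := by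
    intro m n
    have h := pow_le_pow_left₀ (norm_nonneg _) (hp _ ⟨m, n, rfl⟩) 2
    rw [norm_sub_pt2_sq, norm_sq_euclidean_two] at h
    refine le_of_mul_le_mul_left ?_ ha
    nlinarith [congrArg (fun w => w * (a ^ 2 * (n : ℝ) ^ 2)) hs2]
  have k1 := key 1 0
  have k2 := key (-1) 0
  have k3 := key 0 1
  have k4 := key 0 (-1)
  have k5 := key (-1) 1
  have k6 := key 1 (-1)
  push_cast at k1 k2 k3 k4 k5 k6
  refine ⟨abs_le.mpr ⟨by linarith, by linarith⟩, ?_⟩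
  change |p 0| + √3 * |p 1| ≤ 2 * a
  rcases abs_choice (p 0) with h | h <;> rcases abs_choice (p 1) with h' | h' <;>
    rw [h, h'] <;> linarith

lemma volume_vorCell_hexagonal_le {a : ℝ} (ha : 0 < a) :
    volume (vorCell (ΔhexE a)) ≤ ENNReal.ofReal (2 * √3 * a ^ 2) := by
  have hmp := (volume_preserving_finTwoArrow ℝ).comp (PiLp.volume_preserving_ofLp (Fin 2))
  rw [← volume_hexagon ha.le, ← hmp.measure_preimage (measurableSet_hexagon a).nullMeasurableSet]
  exact measure_mono fun p hp => mem_hexagon_of_mem_vorCell ha hp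

lemma integral_cos_norm_vorCell_lt :
    ∫ p in vorCell (ΔhexE (π / 12)), cos ‖p‖ < 2 * √3 * (π / 12) ^ 2 := by
  have ha : 0 < π / 12 := by positivity
  set H := vorCell (ΔhexE (π / 12)) with hH
  have hvol := volume_vorCell_hexagonal_le ha
  rw [← hH] at hvol
  have hfin : volume H < ⊤ := hvol.trans_lt ENNReal.ofReal_lt_top
  by_cases h0 : volume H = 0
  · rw [setIntegral_measure_zero _ h0]
    positivity
  have hmeas : MeasurableSet H := (isClosed_vorCell _).measurableSet
  have hcos : IntegrableOn (fun p : EuclideanSpace ℝ (Fin 2) => cos ‖p‖) H :=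
    IntegrableOn.of_bound hfin (by fun_prop) 1 (Filter.Eventually.of_forall fun p => by
      rw [Real.norm_eq_abs]; exact Real.abs_cos_le_one _)
  have hone : IntegrableOn (fun _ : EuclideanSpace ℝ (Fin 2) => (1:ℝ)) H :=
    integrableOn_const hfin.ne
  have hpos : 0 < ∫ p in H, (1 - cos ‖p‖) := by
    rw [setIntegral_pos_iff_support_of_nonneg_ae
      (Filter.Eventually.of_forall fun p => sub_nonneg.mpr (Real.cos_le_one _)) (hone.sub hcos)]
    have hsub : H \ {0} ⊆
        (Function.support fun p : EuclideanSpace ℝ (Fin 2) => 1 - cos ‖p‖) ∩ H := by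
      rintro p ⟨hp, hp0⟩
      refine ⟨fun hcon => hp0 ?_, hp⟩
      obtain ⟨hx, hy⟩ := mem_hexagon_of_mem_vorCell ha hp
      simp only at hx hy
      have hs : 1 ≤ √3 := Real.one_le_sqrt.mpr (by norm_num)
      have hy' : |p 1| ≤ 2 * (π / 12) := by nlinarith [abs_nonneg (p 0), abs_nonneg (p 1)]
      have hnorm : ‖p‖ < 2 * π := by
        refine lt_of_pow_lt_pow_left₀ 2 (by positivity) ?_
        rw [norm_sq_euclidean_two]
        have := sq_le_sq' (neg_le_of_abs_le hx) (le_of_abs_le hx)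
        have := sq_le_sq' (neg_le_of_abs_le hy') (le_of_abs_le hy')
        nlinarith [pi_pos]
      have := (Real.cos_eq_one_iff_of_lt_of_lt (by linarith [norm_nonneg p, pi_pos]) hnorm).mp
        (sub_eq_zero.mp hcon).symm
      exact norm_eq_zero.mp this
    refine lt_of_lt_of_le ?_ (measure_mono hsub)
    rw [measure_sdiff_null (measure_singleton 0)]
    exact pos_iff_ne_zero.mpr h0
  rw [integral_sub hone hcos, setIntegral_const, smul_eq_mul, mul_one] at hpos
  have hreal : volume.real H ≤ 2 * √3 * (π / 12) ^ 2 :=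
    ENNReal.toReal_le_of_le_ofReal (by positivity) hvol
  linarith

/-- for `a = π/12`, (i) the systole of `(C₆, g_hex)` equals `π/3`, and (ii)
with `V = (4π/3)∫_{H(Δ)} cos‖p‖ dp` the volume of `(C₆, g_hex)`, one has
`(π/3)³ > (2/√3)·V`; hence the systolic ratio of `(C₆, g_hex)` exceeds `2/√3`, the optimal
flat systolic ratio on `C₆`. -/
theorem C6_singular_beats_flat :
    sInf {L : ℝ | ∃ g ∈ Γ₆, g ≠ 1 ∧ ∃ γ₁ γ₂ γ₃ : ℝ → ℝ,
        PC1 γ₁ ∧ PC1 γ₂ ∧ PC1 γ₃ ∧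
        (γ₁ 1, γ₂ 1, γ₃ 1) = g (γ₁ 0, γ₂ 0, γ₃ 0) ∧
        L = sLen (ΔhexE (π / 12)) γ₁ γ₂ γ₃} = π / 3 ∧
    (π / 3) ^ 3 > 2 / Real.sqrt 3 *
      (4 * π / 3 * ∫ p in vorCell (ΔhexE (π / 12)), Real.cos ‖p‖) := by
  refine ⟨?_, ?_⟩
  · refine IsLeast.csInf_eq ⟨exists_loop_sLen_eq, ?_⟩
    rintro L ⟨g, hg, hg1, γ₁, γ₂, γ₃, h₁, h₂, h₃, hend, rfl⟩
    exact pi_div_three_le_sLen_of_mem_Γ₆ hg hg1 h₁ h₂ h₃ hend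
  · have hs : 0 < √3 := by positivity
    calc 2 / √3 * (4 * π / 3 * ∫ p in vorCell (ΔhexE (π / 12)), cos ‖p‖)
        < 2 / √3 * (4 * π / 3 * (2 * √3 * (π / 12) ^ 2)) := by
          gcongr
          exact integral_cos_norm_vorCell_lt
      _ = (π / 3) ^ 3 := by
          field_simp
          norm_num

end
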